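/- arXiv:math/0411293 — 4 statements merged into one kernel-verified Lean document; each statement's English description precedes it below -/
import Mathlib

section
/- Let f be a norm on ℝ^n and let ψ : [1,∞) → (0,∞) be any function increasing to +∞. Then there exists α = (α₁,…,α_n) ∈ ℝ^n with dim_ℤ(1, α₁, …, α_n) = n + 1 (i.e., 1, α₁, …, α_n linearly independent over ℚ) such that, for its f-b.s.a. sequence, f(ξ_ν) · p_{ν+1} = O(ψ(p_{ν+1})) as ν → ∞. -/
open scoped BigOperators

/-- `f` is a (symmetric convex gauge) norm on `ℝ^n`. -/
structure IsGaugeNorm {n : ℕ} (f : (Fin n → ℝ) → ℝ) : Prop where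
  continuous : Continuous f
  nonneg : ∀ x, 0 ≤ f x
  eq_zero_iff : ∀ x, f x = 0 ↔ x = 0
  neg : ∀ x, f (-x) = f x
  smul : ∀ t : ℝ, 0 ≤ t → ∀ x, f (t • x) = t * f x
  add_le : ∀ x y, f (x + y) ≤ f x + f y

/-- The remainder vector `ξ = p·α − a`. -/
noncomputable def xiv {n : ℕ} (α : Fin n → ℝ) (p : ℤ) (a : Fin n → ℤ) : Fin n → ℝ :=
  fun j => (p : ℝ) * α j - (a j : ℝ)

/-- `(p, a)` with `p ≥ 1` is an `f`-best simultaneous approximation to `α`. -/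
def IsFBSA {n : ℕ} (f : (Fin n → ℝ) → ℝ) (α : Fin n → ℝ) (p : ℤ) (a : Fin n → ℤ) : Prop :=
  1 ≤ p ∧
  (∀ (q : ℤ) (b : Fin n → ℤ), 1 ≤ q → q ≤ p - 1 → f (xiv α p a) < f (xiv α q b)) ∧
  (∀ b : Fin n → ℤ, b ≠ a → f (xiv α p a) < f (xiv α p b))

/-- `τ : ℕ → ℤ × ℤ^n` is the (exhaustive) sequence of all `f`-b.s.a. to `α`,
with strictly increasing `p_ν`. -/
def IsFBSASeq {n : ℕ} (f : (Fin n → ℝ) → ℝ) (α : Fin n → ℝ)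
    (τ : ℕ → ℤ × (Fin n → ℤ)) : Prop :=
  (∀ ν : ℕ, IsFBSA f α (τ ν).1 (τ ν).2) ∧
  (∀ ν : ℕ, (τ ν).1 < (τ (ν + 1)).1) ∧
  (∀ (p : ℤ) (a : Fin n → ℤ), IsFBSA f α p a → ∃ ν : ℕ, τ ν = (p, a))

/-- The normalized remainder `Ξ_ν = ξ_ν / f(ξ_ν)`. -/
noncomputable def Xiv {n : ℕ} (f : (Fin n → ℝ) → ℝ) (α : Fin n → ℝ)
    (τ : ℕ → ℤ × (Fin n → ℤ)) (ν : ℕ) : Fin n → ℝ :=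
  (f (xiv α (τ ν).1 (τ ν).2))⁻¹ • xiv α (τ ν).1 (τ ν).2

/-- `f` is strictly convex: the boundary of its unit ball contains no line segment. -/
def StrictlyConvexNorm {n : ℕ} (f : (Fin n → ℝ) → ℝ) : Prop :=
  ∀ x y : Fin n → ℝ, f x = 1 → f y = 1 → x ≠ y →
    ∀ t : ℝ, t ∈ Set.Ioo (0 : ℝ) 1 → f (t • x + (1 - t) • y) < 1

/-- Tails of a series `∑ c k / q k` with bounded numerators and at least doubling denominators. -/
theorem summable_and_abs_tsum_le_of_doubling {q : ℕ → ℕ} (hpos : ∀ k, 0 < q k)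
    (hq : ∀ k, 2 * q k ≤ q (k + 1)) {c : ℕ → ℝ} {M : ℝ} (hc : ∀ k, |c k| ≤ M) (k : ℕ) :
    Summable (fun i => c (i + k) / q (i + k)) ∧
      |∑' i, c (i + k) / q (i + k)| ≤ 2 * M / q k := by
  have hM : 0 ≤ M := (abs_nonneg _).trans (hc 0)
  have hk : (0 : ℝ) < q k := by exact_mod_cast hpos k
  have hgrow : ∀ i, 2 ^ i * q k ≤ q (i + k) := by
    intro i
    induction i with
    | zero => simp
    | succ i ih =>
      have h := hq (i + k)
      rw [show i + 1 + k = i + k + 1 by ring, pow_succ]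
      linarith
  have hterm : ∀ i, ‖c (i + k) / q (i + k)‖ ≤ M / q k * (1 / 2) ^ i := by
    intro i
    have h1 : (2 : ℝ) ^ i * q k ≤ q (i + k) := by exact_mod_cast hgrow i
    have h2 : (0 : ℝ) < 2 ^ i * q k := by positivity
    rw [Real.norm_eq_abs, abs_div, abs_of_pos (h2.trans_le h1)]
    calc |c (i + k)| / q (i + k) ≤ M / (2 ^ i * q k) := by
          gcongr
          exact hc _
      _ = M / q k * (1 / 2) ^ i := by
          rw [one_div, inv_pow]
          field_simp
  have hgeo : HasSum (fun i : ℕ => M / q k * (1 / 2) ^ i) (2 * M / q k) := by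
    rw [show 2 * M / (q k : ℝ) = M / q k * 2 by ring]
    exact hasSum_geometric_two.mul_left _
  exact ⟨Summable.of_norm_bounded hgeo.summable hterm, tsum_of_norm_bounded hgeo hterm⟩

/-- If a series `∑ c (k + 1) / q (k + 1)` with bounded integer numerators and denominators
`q k ∣ q (k + 1)` growing fast enough has an integer sum, then its numerators eventually vanish. -/
theorem eventually_eq_zero_of_tsum_eq_intCast {q : ℕ → ℕ} (hpos : ∀ k, 0 < q k)
    (hq : ∀ k, 2 * q k * q k ≤ q (k + 1)) (hdvd : ∀ k, q k ∣ q (k + 1)) {c : ℕ → ℤ} {M : ℝ}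
    (hc : ∀ k, |(c k : ℝ)| ≤ M) {m : ℤ} (hm : ∑' i, (c (i + 1) : ℝ) / q (i + 1) = m) :
    ∃ K, ∀ k, K ≤ k → c (k + 1) = 0 := by
  have hdouble : ∀ k, 2 * q k ≤ q (k + 1) := fun k =>
    (Nat.le_mul_of_pos_right _ (hpos k)).trans (hq k)
  set T : ℕ → ℝ := fun k => ∑' i, (c (i + (k + 1)) : ℝ) / q (i + (k + 1)) with hT
  have hstep : ∀ k, T k = (c (k + 1) : ℝ) / q (k + 1) + T (k + 1) := by
    intro k
    have hs := (summable_and_abs_tsum_le_of_doubling hpos hdouble hc (k + 1)).1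
    have h := hs.tsum_eq_zero_add
    simp only [hT]
    rw [h]
    simp only [zero_add]
    congr 1
    refine tsum_congr fun i => ?_
    rw [show i + 1 + (k + 1) = i + (k + 1 + 1) by ring]
  have hint : ∀ k, ∃ z : ℤ, (q k : ℝ) * T k = z := by
    intro k
    induction k with
    | zero =>
      refine ⟨q 0 * m, ?_⟩
      have : T 0 = m := hm
      rw [this]
      push_cast
      ring
    | succ k ih =>
      obtain ⟨z, hz⟩ := ih
      obtain ⟨t, ht⟩ := hdvd k
      refine ⟨t * z - c (k + 1), ?_⟩
      have h1 : (0 : ℝ) < q (k + 1) := by exact_mod_cast hpos (k + 1)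
      have h2 : (q (k + 1) : ℝ) = q k * t := by exact_mod_cast ht
      have h3 : (q (k + 1) : ℝ) * T k = c (k + 1) + q (k + 1) * T (k + 1) := by
        rw [hstep k]
        field_simp
      push_cast
      rw [← hz]
      have h4 : (q (k + 1) : ℝ) * T k = t * (q k * T k) := by
        rw [h2]
        ring
      linarith
  have hlarge : ∀ k, k < q k := by
    intro k
    induction k with
    | zero => exact hpos 0
    | succ k ih =>
      have := hdouble k
      omega
  obtain ⟨K, hK⟩ := exists_nat_gt M
  have hzero : ∀ k, K ≤ k → T k = 0 := by
    intro k hk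
    have hqk : (0 : ℝ) < q k := by exact_mod_cast hpos k
    have hqk' : (0 : ℝ) < q (k + 1) := by exact_mod_cast hpos (k + 1)
    have hMk : M < q k := by
      have h1 : K < q k := hk.trans_lt (hlarge k)
      have h2 : (K : ℝ) < q k := by exact_mod_cast h1
      linarith
    have hb : |T k| ≤ 2 * M / q (k + 1) :=
      (summable_and_abs_tsum_le_of_doubling hpos hdouble hc (k + 1)).2
    have hg : (2 : ℝ) * q k * q k ≤ q (k + 1) := by exact_mod_cast hq k
    obtain ⟨z, hz⟩ := hint k
    have hz1 : |(z : ℝ)| < 1 := by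
      rw [← hz, abs_mul, abs_of_pos hqk]
      rw [le_div_iff₀ hqk'] at hb
      have h5 : |T k| * (2 * q k * q k) ≤ 2 * M :=
        (mul_le_mul_of_nonneg_left hg (abs_nonneg _)).trans hb
      by_contra hcon
      push Not at hcon
      nlinarith
    have hz0 : z = 0 := by
      rw [← Int.abs_lt_one_iff]
      exact_mod_cast hz1
    rw [hz0, Int.cast_zero] at hz
    exact (mul_eq_zero.mp hz).resolve_left hqk.ne'
  refine ⟨K, fun k hk => ?_⟩
  have h := hstep k
  rw [hzero k hk, hzero (k + 1) (hk.trans k.le_succ), add_zero] at h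
  have h1 : (q (k + 1) : ℝ) ≠ 0 := by exact_mod_cast (hpos (k + 1)).ne'
  have h2 : (c (k + 1) : ℝ) = 0 := (div_eq_zero_iff.mp h.symm).resolve_right h1
  exact_mod_cast h2

/-- The vector whose `j`-th coordinate is the sum of `1 / q k` over `k ≥ 1` with `k ≡ j` mod `n`. -/
noncomputable def lacunaryVector (n : ℕ) (q : ℕ → ℕ) (j : Fin n) : ℝ :=
  ∑' i, (if (i + 1) % n = j then (1 : ℝ) else 0) / q (i + 1)

theorem linearIndependent_lacunaryVector {n : ℕ} (hn : 1 ≤ n) {q : ℕ → ℕ} (hpos : ∀ k, 0 < q k)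
    (hq : ∀ k, 2 * q k * q k ≤ q (k + 1)) (hdvd : ∀ k, q k ∣ q (k + 1)) :
    LinearIndependent ℚ (Fin.cons 1 (lacunaryVector n q) : Fin (n + 1) → ℝ) := by
  rw [← LinearIndependent.iff_fractionRing ℤ ℚ, Fintype.linearIndependent_iff]
  intro g hg
  have hdouble : ∀ k, 2 * q k ≤ q (k + 1) := fun k =>
    (Nat.le_mul_of_pos_right _ (hpos k)).trans (hq k)
  rw [Fin.sum_univ_succ] at hg
  simp only [Fin.cons_zero, Fin.cons_succ, zsmul_eq_mul, mul_one] at hg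
  have hres : ∀ k : ℕ, k % n < n := fun k => Nat.mod_lt _ hn
  set c : ℕ → ℤ := fun k => g (Fin.succ ⟨k % n, hres k⟩) with hcdef
  have hcsum : ∀ k, (c k : ℝ) = ∑ j : Fin n, (g j.succ : ℝ) * (if k % n = j then 1 else 0) := by
    intro k
    rw [Finset.sum_eq_single ⟨k % n, hres k⟩]
    · simp [hcdef]
    · intro j _ hj
      have : k % n ≠ j := fun h => hj (Fin.ext h.symm)
      simp [this]
    · simp
  have hcb : ∀ k, |(c k : ℝ)| ≤ ∑ j, |(g j : ℝ)| := fun k =>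
    Finset.single_le_sum (f := fun j => |(g j : ℝ)|) (fun j _ => abs_nonneg _)
      (Finset.mem_univ _)
  have hind : ∀ (j : Fin n) (k : ℕ), |(if k % n = j then (1 : ℝ) else 0)| ≤ 1 := by
    intro j k
    split_ifs <;> simp
  have hsum : ∑' i, (c (i + 1) : ℝ) / q (i + 1) = ((-g 0 : ℤ) : ℝ) := by
    have h1 : ∑ j : Fin n, (g j.succ : ℝ) * lacunaryVector n q j =
        ∑' i, (c (i + 1) : ℝ) / q (i + 1) := by
      unfold lacunaryVector
      simp_rw [← tsum_mul_left]
      rw [← Summable.tsum_finsetSum]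
      · refine tsum_congr fun i => ?_
        rw [hcsum, Finset.sum_div]
        refine Finset.sum_congr rfl fun j _ => ?_
        rw [mul_div_assoc]
      · intro j _
        exact (summable_and_abs_tsum_le_of_doubling hpos hdouble (hind j) 1).1.mul_left _
    rw [← h1]
    push_cast
    linarith
  obtain ⟨K, hK⟩ := eventually_eq_zero_of_tsum_eq_intCast hpos hq hdvd hcb hsum
  have hsucc : ∀ j : Fin n, g j.succ = 0 := by
    intro j
    have hk : K ≤ n * (K + 1) + j - 1 := by
      have : K + 1 ≤ n * (K + 1) := Nat.le_mul_of_pos_left _ hn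
      omega
    have h := hK _ hk
    have h1 : n * (K + 1) + j - 1 + 1 = n * (K + 1) + j := by
      have : 1 ≤ n * (K + 1) := Nat.mul_pos hn K.succ_pos
      omega
    have h2 : (n * (K + 1) + j) % n = j := by
      rw [Nat.mul_add_mod, Nat.mod_eq_of_lt j.isLt]
    rw [h1] at h
    simpa only [hcdef, h2] using h
  have hzero : g 0 = 0 := by
    simp only [hsucc, Int.cast_zero, zero_mul, Finset.sum_const_zero, add_zero] at hg
    exact_mod_cast hg
  intro i
  exact Fin.cases hzero hsucc i

/-- Truncating the series defining `lacunaryVector` gives good approximations with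
denominators `q k`. -/
theorem exists_norm_xiv_lacunaryVector_le {n : ℕ} {q : ℕ → ℕ} (hpos : ∀ k, 0 < q k)
    (hq : ∀ k, 2 * q k ≤ q (k + 1)) (hdvd : ∀ k, q k ∣ q (k + 1)) (k : ℕ) :
    ∃ a : Fin n → ℤ, ‖xiv (lacunaryVector n q) (q k) a‖ ≤ 2 * q k / q (k + 1) := by
  have hmono : ∀ i j, i ≤ j → q i ∣ q j := fun i j hij =>
    Nat.le_induction (dvd_refl _) (fun m _ ih => ih.trans (hdvd m)) j hij
  have hk : (0 : ℝ) < q k := by exact_mod_cast hpos k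
  refine ⟨fun j => ∑ i ∈ Finset.range k,
    (if (i + 1) % n = j then 1 else 0) * ((q k / q (i + 1) : ℕ) : ℤ), ?_⟩
  rw [pi_norm_le_iff_of_nonneg (by positivity)]
  intro j
  have hind : ∀ k : ℕ, |(if k % n = j then (1 : ℝ) else 0)| ≤ 1 := by
    intro k
    split_ifs <;> simp
  have hs := (summable_and_abs_tsum_le_of_doubling hpos hq hind 1).1
  have hb := (summable_and_abs_tsum_le_of_doubling hpos hq hind (k + 1)).2
  have hsplit := hs.sum_add_tsum_nat_add k
  have hhead : (q k : ℝ) * ∑ i ∈ Finset.range k,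
      (if (i + 1) % n = j then (1 : ℝ) else 0) / q (i + 1) =
      ((∑ i ∈ Finset.range k,
        (if (i + 1) % n = j then 1 else 0) * ((q k / q (i + 1) : ℕ) : ℤ) : ℤ) : ℝ) := by
    push_cast
    rw [Finset.mul_sum]
    refine Finset.sum_congr rfl fun i hi => ?_
    have hne : (q (i + 1) : ℝ) ≠ 0 := by exact_mod_cast (hpos (i + 1)).ne'
    have hd : q (i + 1) ∣ q k := hmono _ _ (Finset.mem_range.mp hi)
    have hcast : ((q k / q (i + 1) : ℕ) : ℝ) = (q k : ℝ) / q (i + 1) := Nat.cast_div hd hne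
    split_ifs
    · rw [one_mul, ← hcast.trans (by ring : (q k : ℝ) / q (i + 1) = q k * (1 / q (i + 1)))]
      norm_cast
    · simp
  have hval : xiv (lacunaryVector n q) (q k) (fun j => ∑ i ∈ Finset.range k,
      (if (i + 1) % n = j then 1 else 0) * ((q k / q (i + 1) : ℕ) : ℤ)) j =
      q k * ∑' i, (if (i + (k + 1)) % n = j then (1 : ℝ) else 0) / q (i + (k + 1)) := by
    unfold xiv lacunaryVector
    rw [← hhead, ← hsplit]
    simp only [Int.cast_natCast, add_assoc]
    ring
  rw [hval, Real.norm_eq_abs, abs_mul, abs_of_pos hk]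
  calc (q k : ℝ) * _ ≤ q k * (2 * 1 / q (k + 1)) := by gcongr
    _ = 2 * q k / q (k + 1) := by ring

theorem IsGaugeNorm.exists_norm_bounds {n : ℕ} (hn : 1 ≤ n) {f : (Fin n → ℝ) → ℝ}
    (hf : IsGaugeNorm f) :
    ∃ c C : ℝ, 0 < c ∧ 0 < C ∧ ∀ x, c * ‖x‖ ≤ f x ∧ f x ≤ C * ‖x‖ := by
  have : Nonempty (Fin n) := ⟨⟨0, hn⟩⟩
  have hcomp : IsCompact (Metric.sphere (0 : Fin n → ℝ) 1) := isCompact_sphere _ _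
  have hne : (Metric.sphere (0 : Fin n → ℝ) 1).Nonempty := NormedSpace.sphere_nonempty.mpr zero_le_one
  obtain ⟨u, hu, hmin⟩ := hcomp.exists_isMinOn hne hf.continuous.continuousOn
  obtain ⟨v, hv, hmax⟩ := hcomp.exists_isMaxOn hne hf.continuous.continuousOn
  have hfpos : ∀ w ∈ Metric.sphere (0 : Fin n → ℝ) 1, 0 < f w := by
    intro w hw
    refine lt_of_le_of_ne (hf.nonneg w) fun h => ?_
    have : w = 0 := (hf.eq_zero_iff w).mp h.symm
    simp [this] at hw
  refine ⟨f u, f v, hfpos u hu, hfpos v hv, fun x => ?_⟩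
  rcases eq_or_ne x 0 with rfl | hx
  · simp [(hf.eq_zero_iff 0).mpr rfl]
  have hxn : 0 < ‖x‖ := norm_pos_iff.mpr hx
  have hmem : ‖x‖⁻¹ • x ∈ Metric.sphere (0 : Fin n → ℝ) 1 := by
    rw [mem_sphere_zero_iff_norm, norm_smul, norm_inv, norm_norm, inv_mul_cancel₀ hxn.ne']
  have hfx : f x = f (‖x‖⁻¹ • x) * ‖x‖ := by
    rw [hf.smul _ (inv_nonneg.mpr hxn.le)]
    field_simp
  rw [hfx]
  exact ⟨mul_le_mul_of_nonneg_right (hmin hmem) hxn.le,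
    mul_le_mul_of_nonneg_right (hmax hmem) hxn.le⟩

/-- Two integer points at the same height cannot both have small remainders. -/
theorem IsGaugeNorm.le_add_xiv {n : ℕ} {f : (Fin n → ℝ) → ℝ} (hf : IsGaugeNorm f) {c : ℝ}
    (hc : 0 < c) (hcf : ∀ x, c * ‖x‖ ≤ f x) (α : Fin n → ℝ) (p : ℤ) {a b : Fin n → ℤ}
    (hab : a ≠ b) : c ≤ f (xiv α p a) + f (xiv α p b) := by
  obtain ⟨j, hj⟩ := Function.ne_iff.mp hab
  have h1 : (1 : ℝ) ≤ ‖xiv α p a + -xiv α p b‖ := by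
    refine le_trans ?_ (norm_le_pi_norm _ j)
    have h2 : (xiv α p a + -xiv α p b) j = ((b j - a j : ℤ) : ℝ) := by
      simp only [xiv, Pi.add_apply, Pi.neg_apply]
      push_cast
      ring
    rw [h2, Real.norm_eq_abs]
    exact_mod_cast Int.one_le_abs (sub_ne_zero.mpr (Ne.symm hj))
  calc c ≤ c * ‖xiv α p a + -xiv α p b‖ := le_mul_of_one_le_right hc.le h1
    _ ≤ f (xiv α p a + -xiv α p b) := hcf _
    _ ≤ f (xiv α p a) + f (-xiv α p b) := hf.add_le _ _
    _ = f (xiv α p a) + f (xiv α p b) := by rw [hf.neg]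

theorem xiv_zero_right {n : ℕ} (α : Fin n → ℝ) (p : ℤ) : xiv α p 0 = (p : ℝ) • α := by
  ext j
  simp [xiv]

theorem IsFBSA.le_apply_self {n : ℕ} {f : (Fin n → ℝ) → ℝ} {α : Fin n → ℝ} {p : ℤ}
    {a : Fin n → ℤ} (h : IsFBSA f α p a) : f (xiv α p a) ≤ f α := by
  have h1 : xiv α 1 0 = α := by simp [xiv_zero_right]
  rcases h.1.eq_or_lt with rfl | hp
  · by_cases ha : 0 = a
    · rw [← ha, h1]
    · simpa only [h1] using (h.2.2 0 ha).le
  · simpa only [h1] using (h.2.1 1 0 le_rfl (by omega)).le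

/-- Between consecutive best approximations there is no better one, as soon as `f α` is small. -/
theorem IsFBSASeq.le_of_lt {n : ℕ} {f : (Fin n → ℝ) → ℝ} (hf : IsGaugeNorm f) {c : ℝ}
    (hc : 0 < c) (hcf : ∀ x, c * ‖x‖ ≤ f x) {α : Fin n → ℝ} (hα : f α ≤ c / 2)
    {τ : ℕ → ℤ × (Fin n → ℤ)} (hτ : IsFBSASeq f α τ) (ν : ℕ) {q : ℕ} (hq : 1 ≤ q)
    (hlt : (q : ℤ) < (τ (ν + 1)).1) (b : Fin n → ℤ) :
    f (xiv α (τ ν).1 (τ ν).2) ≤ f (xiv α q b) := by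
  induction q using Nat.strong_induction_on generalizing b with
  | _ q ih =>
    by_contra! hcon
    have hν := hτ.1 ν
    have hge : (τ ν).1 < q := by
      by_contra! hle
      rcases hle.eq_or_lt with heq | hlt'
      · rw [heq] at hcon
        by_cases hb : b = (τ ν).2
        · rw [hb] at hcon
          exact lt_irrefl _ hcon
        · exact lt_asymm hcon (hν.2.2 b hb)
      · exact lt_asymm hcon (hν.2.1 q b (by omega) (by omega))
    have hbest : IsFBSA f α q b := by
      refine ⟨by omega, fun r d hr1 hr2 => ?_, fun d hd => ?_⟩
      · lift r to ℕ using by omega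
        exact hcon.trans_le (ih r (by omega) (by omega) (by omega) d)
      · have h1 := hf.le_add_xiv hc hcf α q hd
        have h2 := hν.le_apply_self
        linarith
    obtain ⟨μ, hμ⟩ := hτ.2.2 _ _ hbest
    have hmono : StrictMono fun ν => (τ ν).1 := strictMono_nat_of_lt_succ hτ.2.1
    have h1 : (τ μ).1 = q := by rw [hμ]
    have h2 : ν < μ := hmono.lt_iff_lt.mp (by simpa only [h1] using hge)
    have h3 : μ < ν + 1 := hmono.lt_iff_lt.mp (by simpa only [h1] using hlt)
    omega

/-- If `Q * f α` is small, the second best approximation has denominator larger than `Q`. -/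
theorem IsFBSASeq.lt_succ {n : ℕ} {f : (Fin n → ℝ) → ℝ} (hf : IsGaugeNorm f) {c : ℝ}
    (hc : 0 < c) (hcf : ∀ x, c * ‖x‖ ≤ f x) {α : Fin n → ℝ} {Q : ℕ} (hQ : 1 ≤ Q)
    (hα : Q * f α ≤ c / 2) {τ : ℕ → ℤ × (Fin n → ℤ)} (hτ : IsFBSASeq f α τ) (ν : ℕ) :
    (Q : ℤ) < (τ (ν + 1)).1 := by
  by_contra! hle
  have hbest := hτ.1 (ν + 1)
  have h1 : 1 < (τ (ν + 1)).1 := (hτ.1 ν).1.trans_lt (hτ.2.1 ν)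
  have h2 : f (xiv α (τ (ν + 1)).1 (τ (ν + 1)).2) < f α := by
    simpa [xiv_zero_right] using hbest.2.1 1 0 le_rfl (by omega)
  have hp1 : (1 : ℝ) ≤ (τ (ν + 1)).1 := by exact_mod_cast h1.le
  have hpQ : ((τ (ν + 1)).1 : ℝ) ≤ Q := by exact_mod_cast hle
  have hf0 := hf.nonneg α
  have h3 : f (xiv α (τ (ν + 1)).1 0) = (τ (ν + 1)).1 * f α := by
    rw [xiv_zero_right, hf.smul _ (by linarith)]
  by_cases h0 : (τ (ν + 1)).2 = 0
  · rw [h0, h3] at h2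
    nlinarith
  · have h4 := hf.le_add_xiv hc hcf α (τ (ν + 1)).1 h0
    rw [h3] at h4
    have hQ' : (1 : ℝ) ≤ Q := by exact_mod_cast hQ
    have h5 : ((τ (ν + 1)).1 : ℝ) * f α ≤ Q * f α := mul_le_mul_of_nonneg_right hpQ hf0
    nlinarith

/-- For any norm `f` and any `ψ` increasing to `+∞` there exists `α`
with `1, α₁, …, α_n` linearly independent over `ℚ` (i.e. `dim_ℤ(1,α) = n+1`) such that
`f(ξ_ν) · p_{ν+1} = O(ψ(p_{ν+1}))`. -/
theorem stmt10 (n : ℕ) (hn : 1 ≤ n) (f : (Fin n → ℝ) → ℝ) (hf : IsGaugeNorm f)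
    (ψ : ℝ → ℝ) (hψmono : MonotoneOn ψ (Set.Ici 1))
    (hψtop : Filter.Tendsto ψ Filter.atTop Filter.atTop) :
    ∃ α : Fin n → ℝ,
      Module.finrank ℚ ↥(Submodule.span ℚ (insert (1 : ℝ) (Set.range α))) = n + 1 ∧
      ∀ τ : ℕ → ℤ × (Fin n → ℤ), IsFBSASeq f α τ →
        ∃ C : ℝ, 0 < C ∧ ∀ ν : ℕ,
          f (xiv α (τ ν).1 (τ ν).2) * ((τ (ν + 1)).1 : ℝ) ≤
            C * ψ (((τ (ν + 1)).1 : ℝ)) := by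
  obtain ⟨c, C, hc, hC, hcC⟩ := hf.exists_norm_bounds hn
  have hN : ∀ m : ℕ, ∃ N : ℕ, m ≤ N ∧ 1 ≤ N ∧ ∀ x : ℝ, (N : ℝ) ≤ x → 2 * (m : ℝ) ≤ ψ x := by
    intro m
    obtain ⟨x₀, hx₀⟩ := Filter.eventually_atTop.mp (hψtop.eventually_ge_atTop (2 * (m : ℝ)))
    obtain ⟨k, hk⟩ := exists_nat_ge x₀
    refine ⟨max (max m 1) k, by omega, by omega, fun x hx => hx₀ x ?_⟩
    have : (k : ℝ) ≤ (max (max m 1) k : ℕ) := by exact_mod_cast le_max_right _ _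
    linarith
  choose N hmN h1N hψN using hN
  obtain ⟨Q, hQ⟩ := exists_nat_ge (2 * C / c)
  set Q₀ : ℕ := max Q (N 1) with hQ₀
  have hQ₀pos : 1 ≤ Q₀ := (h1N 1).trans (le_max_right _ _)
  set q : ℕ → ℕ := fun k => Nat.rec Q₀ (fun _ m => m * (2 * N m)) k with hqdef
  have hq0 : q 0 = Q₀ := rfl
  have hqs : ∀ k, q (k + 1) = q k * (2 * N (q k)) := fun k => rfl
  have hpos : ∀ k, 0 < q k := by
    intro k
    induction k with
    | zero => exact hQ₀pos
    | succ k ih =>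
      rw [hqs]
      have := h1N (q k)
      positivity
  have hdvd : ∀ k, q k ∣ q (k + 1) := fun k => ⟨_, hqs k⟩
  have hsq : ∀ k, 2 * q k * q k ≤ q (k + 1) := by
    intro k
    rw [hqs]
    nlinarith [hmN (q k)]
  have hdouble : ∀ k, 2 * q k ≤ q (k + 1) := fun k =>
    (Nat.le_mul_of_pos_right _ (hpos k)).trans (hsq k)
  set α := lacunaryVector n q with hαdef
  have happrox : ∀ k, ∃ a : Fin n → ℤ, f (xiv α (q k) a) * N (q k) ≤ C := by
    intro k
    obtain ⟨a, ha⟩ := exists_norm_xiv_lacunaryVector_le (n := n) hpos hdouble hdvd k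
    refine ⟨a, ?_⟩
    have hqk : (0 : ℝ) < q k := by exact_mod_cast hpos k
    have hNk : (0 : ℝ) < N (q k) := by exact_mod_cast h1N (q k)
    have h1 : 2 * (q k : ℝ) / q (k + 1) = 1 / N (q k) := by
      rw [hqs]
      push_cast
      field_simp
    rw [h1, le_div_iff₀ hNk] at ha
    have h2 := mul_le_mul_of_nonneg_right (hcC (xiv α (q k) a)).2 hNk.le
    nlinarith
  have hnorm : ‖α‖ ≤ 2 / q 1 := by
    rw [pi_norm_le_iff_of_nonneg (by positivity)]
    intro j
    have hind : ∀ k : ℕ, |(if k % n = j then (1 : ℝ) else 0)| ≤ 1 := by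
      intro k
      split_ifs <;> simp
    simpa [hαdef, lacunaryVector] using
      (summable_and_abs_tsum_le_of_doubling hpos hdouble hind 1).2
  have hQα : Q₀ * f α ≤ c / 2 := by
    have hQ₀' : (0 : ℝ) < Q₀ := by exact_mod_cast hQ₀pos
    have h1 : (2 : ℝ) * Q₀ * Q₀ ≤ q 1 := by exact_mod_cast hsq 0
    have h2 : 2 * C / c ≤ Q₀ := hQ.trans (by exact_mod_cast le_max_left _ _)
    rw [div_le_iff₀ hc] at h2
    have h3 : f α ≤ C * (2 / (2 * Q₀ * Q₀)) :=
      (hcC α).2.trans (by gcongr; exact hnorm.trans (by gcongr))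
    calc Q₀ * f α ≤ Q₀ * (C * (2 / (2 * Q₀ * Q₀))) := by gcongr
      _ = C / Q₀ := by field_simp
      _ ≤ c / 2 := by
        rw [div_le_div_iff₀ hQ₀' two_pos]
        linarith
  have hα : f α ≤ c / 2 := by
    have : (1 : ℝ) ≤ Q₀ := by exact_mod_cast hQ₀pos
    nlinarith [hf.nonneg α]
  have hψ1 : ∀ x : ℝ, (Q₀ : ℝ) ≤ x → 1 ≤ ψ x := by
    intro x hx
    have h1 : (N 1 : ℝ) ≤ Q₀ := by exact_mod_cast le_max_right _ _
    have := hψN 1 x (h1.trans hx)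
    push_cast at this
    linarith
  refine ⟨α, ?_, fun τ hτ => ⟨C, hC, fun ν => ?_⟩⟩
  · have h := finrank_span_eq_card (linearIndependent_lacunaryVector hn hpos hsq hdvd)
    rwa [Fin.range_cons, Fintype.card_fin] at h
  · have hbig := hτ.lt_succ hf hc (fun x => (hcC x).1) hQ₀pos hQα ν
    obtain ⟨X, hX⟩ : ∃ X : ℕ, (τ (ν + 1)).1 = X := ⟨_, (Int.toNat_of_nonneg (by omega)).symm⟩
    have hQX : Q₀ < X := by omega
    obtain ⟨k, hk1, hk2⟩ : ∃ k, q k < X ∧ X ≤ q (k + 1) := by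
      have hex : ∃ k, X ≤ q k := by
        have hmono : StrictMono q := strictMono_nat_of_lt_succ fun k => by
          have := hdouble k
          have := hpos k
          omega
        exact ⟨X, hmono.le_apply⟩
      have hne : Nat.find hex ≠ 0 := by
        intro h0
        have := Nat.find_spec hex
        rw [h0, hq0] at this
        omega
      obtain ⟨k, hk⟩ := Nat.exists_eq_succ_of_ne_zero hne
      have hspec := Nat.find_spec hex
      rw [hk] at hspec
      refine ⟨k, ?_, hspec⟩
      exact not_le.mp (Nat.find_min hex (by omega))
    obtain ⟨a, ha⟩ := happrox k
    have hle := hτ.le_of_lt hf hc (fun x => (hcC x).1) hα ν (hpos k) (by omega) a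
    rw [hX, Int.cast_natCast]
    have hψX : 1 ≤ ψ X := hψ1 X (by exact_mod_cast hQX.le)
    have hNk : (0 : ℝ) < N (q k) := by exact_mod_cast h1N (q k)
    have hXN : (X : ℝ) ≤ N (q k) * ψ X := by
      rcases le_total (N (q k) : ℝ) X with h | h
      · have h1 := hψN (q k) X h
        have h2 : (X : ℝ) ≤ q k * (2 * N (q k)) := by exact_mod_cast hk2.trans_eq (hqs k)
        nlinarith
      · nlinarith
    calc f (xiv α (τ ν).1 (τ ν).2) * X ≤ f (xiv α (q k) a) * (N (q k) * ψ X) :=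
          mul_le_mul hle hXN (Nat.cast_nonneg _) (hf.nonneg _)
      _ = f (xiv α (q k) a) * N (q k) * ψ X := by ring
      _ ≤ C * ψ X := mul_le_mul_of_nonneg_right ha (by linarith)
end

section
/- Let f be a strictly convex norm on ℝ^n. Then there exists δ = δ(f) > 0 such that for every α ∈ ℝ^n with α ∉ ℚ^n there exist infinitely many indices ν for which Ξ_{ν+1} ∉ B_f^{1+δ}(Ξ_ν), i.e., f(Ξ_{ν+1} − Ξ_ν) > 1 + δ. -/
open scoped BigOperators

namespace IsGaugeNorm

variable {n : ℕ} {f : (Fin n → ℝ) → ℝ}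

lemma sub_comm (hf : IsGaugeNorm f) (x y : Fin n → ℝ) : f (x - y) = f (y - x) := by
  rw [← hf.neg, neg_sub]

lemma sub_le (hf : IsGaugeNorm f) (x y : Fin n → ℝ) : f (x - y) ≤ f x + f y := by
  simpa [sub_eq_add_neg, hf.neg] using hf.add_le x (-y)

lemma convexComb_le (hf : IsGaugeNorm f) {t : ℝ} (h0 : 0 ≤ t) (h1 : t ≤ 1)
    (x y : Fin n → ℝ) : f (t • x + (1 - t) • y) ≤ t * f x + (1 - t) * f y := by
  have h := hf.add_le (t • x) ((1 - t) • y)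
  rwa [hf.smul t h0, hf.smul (1 - t) (by linarith)] at h

lemma exists_mul_norm_le (hf : IsGaugeNorm f) : ∃ c : ℝ, 0 < c ∧ ∀ x, c * ‖x‖ ≤ f x := by
  rcases (Metric.sphere (0 : Fin n → ℝ) 1).eq_empty_or_nonempty with he | hne
  · refine ⟨1, one_pos, fun x => ?_⟩
    rcases eq_or_ne x 0 with rfl | hx
    · simpa using hf.nonneg 0
    · have : ‖x‖⁻¹ • x ∈ Metric.sphere (0 : Fin n → ℝ) 1 := by
        simp [norm_smul, norm_ne_zero_iff.2 hx]
      simp [he] at this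
  · obtain ⟨z, hz, hmin⟩ := (isCompact_sphere (0 : Fin n → ℝ) 1).exists_isMinOn hne
      hf.continuous.continuousOn
    have hz0 : z ≠ 0 := by
      rintro rfl
      simp at hz
    refine ⟨f z, lt_of_le_of_ne (hf.nonneg z) fun h => hz0 ((hf.eq_zero_iff z).1 h.symm),
      fun x => ?_⟩
    rcases eq_or_ne x 0 with rfl | hx
    · simpa using hf.nonneg 0
    · have hx' : 0 < ‖x‖ := norm_pos_iff.2 hx
      have hmem : ‖x‖⁻¹ • x ∈ Metric.sphere (0 : Fin n → ℝ) 1 := by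
        simp [norm_smul, hx'.ne']
      have h : f z ≤ f (‖x‖⁻¹ • x) := hmin hmem
      rw [hf.smul _ (inv_nonneg.2 hx'.le), inv_mul_eq_div, le_div_iff₀ hx'] at h
      exact h

lemma isCompact_ball (hf : IsGaugeNorm f) : IsCompact {x | f x ≤ 1} := by
  obtain ⟨c, hc, h⟩ := hf.exists_mul_norm_le
  refine Metric.isCompact_of_isClosed_isBounded (isClosed_le hf.continuous continuous_const)
    (isBounded_iff_forall_norm_le.2 ⟨c⁻¹, fun x hx => ?_⟩)
  rw [← one_div, le_div_iff₀ hc, mul_comm]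
  exact (h x).trans hx

lemma isCompact_sphere (hf : IsGaugeNorm f) : IsCompact {x | f x = 1} :=
  hf.isCompact_ball.of_isClosed_subset (isClosed_eq hf.continuous continuous_const)
    fun _ hx => le_of_eq hx

lemma exists_le_intCast (hf : IsGaugeNorm f) :
    ∃ c : ℝ, 0 < c ∧ ∀ b : Fin n → ℤ, b ≠ 0 → c ≤ f fun j => (b j : ℝ) := by
  obtain ⟨c, hc, h⟩ := hf.exists_mul_norm_le
  refine ⟨c, hc, fun b hb => ?_⟩
  obtain ⟨j, hj⟩ := Function.ne_iff.1 hb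
  have h1 : (1 : ℝ) ≤ ‖(fun j => (b j : ℝ))‖ := by
    refine le_trans ?_ (norm_le_pi_norm (fun j => (b j : ℝ)) j)
    rw [Real.norm_eq_abs]
    exact_mod_cast Int.one_le_abs hj
  exact (le_mul_of_one_le_right hc.le h1).trans (h _)

/-- The size of a subset of the unit ball with pairwise distances at least `1 / 2` is bounded. -/
lemma exists_card_bound (hf : IsGaugeNorm f) :
    ∃ K : ℕ, ∀ u : ℕ → Fin n → ℝ, (∀ i ≤ K, f (u i) ≤ 1) →
      ∃ i j, i < j ∧ j ≤ K ∧ f (u j - u i) < 1 / 2 := by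
  obtain ⟨T, hT⟩ := hf.isCompact_ball.elim_finite_subcover
    (fun c : Fin n → ℝ => {y | f (y - c) < 1 / 4})
    (fun c => isOpen_lt (hf.continuous.comp (continuous_id.sub continuous_const))
      continuous_const)
    (fun x _ => Set.mem_iUnion.2 ⟨x, by simp [(hf.eq_zero_iff 0).2 rfl]⟩)
  refine ⟨T.card, fun u hu => ?_⟩
  have hex : ∀ i ∈ Finset.range (T.card + 1), ∃ c ∈ T, f (u i - c) < 1 / 4 := by
    intro i hi
    have := hT (show u i ∈ {x | f x ≤ 1} from hu i (by simpa [Nat.lt_succ_iff] using hi))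
    simpa using this
  choose! g hgT hg using hex
  obtain ⟨i, hi, j, hj, hij, he⟩ := Finset.exists_ne_map_eq_of_card_lt_of_maps_to
    (s := Finset.range (T.card + 1)) (t := T) (by simp) hgT
  have key : ∀ i ∈ Finset.range (T.card + 1), ∀ j ∈ Finset.range (T.card + 1), g i = g j →
      f (u j - u i) < 1 / 2 := by
    intro i hi j hj he
    have h1 := hf.sub_le (u j - g j) (u i - g i)
    have h2 := hg i hi
    have h3 := hg j hj
    rw [he, sub_sub_sub_cancel_right] at h1
    rw [he] at h2
    linarith
  rcases lt_or_gt_of_ne hij with h | h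
  · exact ⟨i, j, h, by simpa [Nat.lt_succ_iff] using hj, key i hi j hj he⟩
  · exact ⟨j, i, h, by simpa [Nat.lt_succ_iff] using hi, key j hj i hi he.symm⟩

/-- For unit vectors of a strictly convex norm, `1 ≤ f (x - ρ • z)` forces `f (x - z)` to exceed
`1` by a uniform amount. -/
lemma exists_gap (hf : IsGaugeNorm f) (hsc : StrictlyConvexNorm f) {ρ : ℝ} (h0 : 0 < ρ)
    (h1 : ρ < 1) :
    ∃ δ : ℝ, 0 < δ ∧ ∀ x z, f x = 1 → f z = 1 → 1 ≤ f (x - ρ • z) → 1 + δ < f (x - z) := by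
  have hlt : ∀ x z, f x = 1 → f z = 1 → 1 ≤ f (x - ρ • z) → 1 < f (x - z) := by
    intro x z hx hz h
    by_contra! hle
    have hcomb : x - ρ • z = ρ • (x - z) + (1 - ρ) • x := by module
    rw [hcomb] at h
    rcases hle.lt_or_eq with hl | he
    · have := hf.convexComb_le h0.le h1.le (x - z) x
      nlinarith
    · refine absurd (hsc (x - z) x he hx (fun hxz => ?_) ρ ⟨h0, h1⟩) (not_lt.2 h)
      have : z = 0 := by simpa using hxz
      rw [this, (hf.eq_zero_iff 0).2 rfl] at hz
      exact zero_ne_one hz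
  have hc := hf.continuous
  let S : Set ((Fin n → ℝ) × (Fin n → ℝ)) :=
    ({x | f x = 1} ×ˢ {x | f x = 1}) ∩ {w | 1 ≤ f (w.1 - ρ • w.2)}
  have hS : IsCompact S := (hf.isCompact_sphere.prod hf.isCompact_sphere).inter_right
    (isClosed_le continuous_const (by fun_prop))
  rcases S.eq_empty_or_nonempty with he | hne
  · refine ⟨1, one_pos, fun x z hx hz h => ?_⟩
    have : (x, z) ∈ S := ⟨⟨hx, hz⟩, h⟩
    simp [he] at this
  · obtain ⟨w, hw, hmin⟩ := hS.exists_isMinOn hne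
      (f := fun w : (Fin n → ℝ) × (Fin n → ℝ) => f (w.1 - w.2)) (by fun_prop)
    have hw1 := hlt w.1 w.2 hw.1.1 hw.1.2 hw.2
    refine ⟨(f (w.1 - w.2) - 1) / 2, by linarith, fun x z hx hz h => ?_⟩
    have : f (w.1 - w.2) ≤ f (x - z) := hmin (show (x, z) ∈ S from ⟨⟨hx, hz⟩, h⟩)
    linarith

end IsGaugeNorm

lemma xiv_sub {n : ℕ} (α : Fin n → ℝ) (p q : ℤ) (a b : Fin n → ℤ) :
    xiv α p a - xiv α q b = xiv α (p - q) (a - b) := by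
  ext j
  simp [xiv]
  ring

/-- The approximation error `f (ξ_ν)`. -/
noncomputable def remainderNorm {n : ℕ} (f : (Fin n → ℝ) → ℝ) (α : Fin n → ℝ)
    (τ : ℕ → ℤ × (Fin n → ℤ)) (ν : ℕ) : ℝ :=
  f (xiv α (τ ν).1 (τ ν).2)

namespace IsFBSASeq

variable {n : ℕ} {f : (Fin n → ℝ) → ℝ} {α : Fin n → ℝ} {τ : ℕ → ℤ × (Fin n → ℤ)}

lemma strictMono (h : IsFBSASeq f α τ) : StrictMono fun ν => (τ ν).1 :=
  strictMono_nat_of_lt_succ h.2.1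

lemma strictAnti (h : IsFBSASeq f α τ) : StrictAnti (remainderNorm f α τ) :=
  strictAnti_nat_of_succ_lt fun ν =>
    (h.1 (ν + 1)).2.1 _ _ (h.1 ν).1 (by have := h.2.1 ν; omega)

lemma remainderNorm_pos (h : IsFBSASeq f α τ) (hf : IsGaugeNorm f) (ν : ℕ) :
    0 < remainderNorm f α τ ν :=
  (hf.nonneg _).trans_lt (h.strictAnti ν.lt_succ_self)

lemma remainderNorm_lt_sub (h : IsFBSASeq f α τ) {i j : ℕ} (hij : i < j) :
    remainderNorm f α τ j < f (xiv α (τ j).1 (τ j).2 - xiv α (τ i).1 (τ i).2) := by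
  rw [xiv_sub]
  have h1 : (τ i).1 < (τ j).1 := h.strictMono hij
  have h2 := (h.1 i).1
  exact (h.1 j).2.1 _ _ (by omega) (by omega)

lemma exists_halving (hf : IsGaugeNorm f) :
    ∃ K : ℕ, ∀ (α : Fin n → ℝ) (τ : ℕ → ℤ × (Fin n → ℤ)), IsFBSASeq f α τ →
      ∀ ν, remainderNorm f α τ (ν + K) < remainderNorm f α τ ν / 2 := by
  obtain ⟨K, hK⟩ := hf.exists_card_bound
  refine ⟨K, fun α τ h ν => ?_⟩
  have hpos := h.remainderNorm_pos hf ν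
  have hinv := inv_nonneg.2 hpos.le
  obtain ⟨i, j, hij, hjK, hlt⟩ := hK
    (fun i => (remainderNorm f α τ ν)⁻¹ • xiv α (τ (ν + i)).1 (τ (ν + i)).2) (fun i _ => by
      rw [hf.smul _ hinv, inv_mul_le_one₀ hpos]
      exact h.strictAnti.antitone (Nat.le_add_right ν i))
  rw [← smul_sub, hf.smul _ hinv, inv_mul_lt_iff₀ hpos] at hlt
  have h1 := h.remainderNorm_lt_sub (show ν + i < ν + j by omega)
  have h2 := h.strictAnti.antitone (show ν + j ≤ ν + K by omega)
  linarith

lemma exists_remainderNorm_lt (h : IsFBSASeq f α τ) (hf : IsGaugeNorm f) {c : ℝ}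
    (hc : 0 < c) : ∃ N, ∀ ν ≥ N, remainderNorm f α τ ν < c := by
  obtain ⟨K, hK⟩ := exists_halving hf
  have hpow : ∀ m : ℕ, remainderNorm f α τ (m * K) ≤ remainderNorm f α τ 0 * (1 / 2) ^ m := by
    intro m
    induction m with
    | zero => simp
    | succ m ih =>
      have := hK α τ h (m * K)
      rw [add_one_mul, pow_succ]
      linarith
  have h0 := h.remainderNorm_pos hf 0
  obtain ⟨m, hm⟩ := exists_pow_lt_of_lt_one (div_pos hc h0)
    (show (1 / 2 : ℝ) < 1 by norm_num)
  rw [lt_div_iff₀ h0, mul_comm] at hm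
  exact ⟨m * K, fun ν hν => (h.strictAnti.antitone hν).trans_lt ((hpow m).trans_lt hm)⟩

/-- Once the error is small compared with the integer lattice, nothing before `p_{ν+1}` beats
the `ν`-th best approximation. -/
lemma remainderNorm_le (h : IsFBSASeq f α τ) (hf : IsGaugeNorm f) {c : ℝ}
    (hc : ∀ b : Fin n → ℤ, b ≠ 0 → c ≤ f fun j => (b j : ℝ)) {ν : ℕ}
    (hν : remainderNorm f α τ ν < c / 2) {q : ℤ} (hq1 : 1 ≤ q) (hq : q < (τ (ν + 1)).1)
    (b : Fin n → ℤ) : remainderNorm f α τ ν ≤ f (xiv α q b) := by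
  by_contra! hlt
  have hex : ∃ m : ℕ, 1 ≤ m ∧ ∃ b, f (xiv α (m : ℤ) b) < remainderNorm f α τ ν :=
    ⟨q.toNat, by omega, b, by rwa [Int.toNat_of_nonneg (by omega)]⟩
  classical
  obtain ⟨hm1, b', hb'⟩ := Nat.find_spec hex
  have hmin := fun k => Nat.find_min (m := k) hex
  have hmq : Nat.find hex ≤ q.toNat :=
    Nat.find_min' hex ⟨by omega, b, by rwa [Int.toNat_of_nonneg (by omega)]⟩
  set m := Nat.find hex
  have hbsa : IsFBSA f α m b' := by
    refine ⟨by omega, fun k d hk1 hk => hb'.trans_le ?_, fun d hd => hb'.trans_le ?_⟩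
    · by_contra! hkd
      exact hmin k.toNat (by omega)
        ⟨by omega, d, by rwa [Int.toNat_of_nonneg (by omega)]⟩
    · by_contra! hd'
      have h1 := hc (b' - d) (sub_ne_zero.2 hd.symm)
      have h2 := hf.sub_le (xiv α m d) (xiv α m b')
      have h3 : xiv α m d - xiv α m b' = fun j => (((b' - d) j : ℤ) : ℝ) := by
        ext j
        simp [xiv]
      rw [h3] at h2
      linarith
  obtain ⟨μ, hμ⟩ := h.2.2 _ _ hbsa
  have hμν : μ < ν + 1 := h.strictMono.lt_iff_lt.1 (by simp only [hμ]; omega)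
  have h4 := h.strictAnti.antitone (Nat.lt_succ_iff.1 hμν)
  have h5 : remainderNorm f α τ μ = f (xiv α m b') := by simp [remainderNorm, hμ]
  linarith

end IsFBSASeq

/-- For a strictly convex norm `f` there is `δ = δ(f) > 0` such that
for every `α ∉ ℚ^n` infinitely many `ν` satisfy `f(Ξ_{ν+1} − Ξ_ν) > 1 + δ`. -/
theorem stmt12 (n : ℕ) (f : (Fin n → ℝ) → ℝ) (hf : IsGaugeNorm f)
    (hsc : StrictlyConvexNorm f) :
    ∃ δ : ℝ, 0 < δ ∧
      ∀ α : Fin n → ℝ, (¬ ∀ j : Fin n, ∃ q : ℚ, (q : ℝ) = α j) →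
        ∀ τ : ℕ → ℤ × (Fin n → ℤ), IsFBSASeq f α τ →
          {ν : ℕ | 1 + δ < f (Xiv f α τ (ν + 1) - Xiv f α τ ν)}.Infinite := by
  obtain ⟨K, hK⟩ := IsFBSASeq.exists_halving hf
  obtain ⟨c, hc, hcb⟩ := hf.exists_le_intCast
  obtain ⟨ρ, hρ0, hρ1, hρK⟩ : ∃ ρ : ℝ, 0 < ρ ∧ ρ < 1 ∧ 1 / 2 ≤ ρ ^ K := by
    have hcont : Filter.Tendsto (fun x : ℝ => x ^ K) (nhdsWithin 1 (Set.Iio 1)) (nhds 1) := by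
      simpa using ((continuous_pow K).tendsto (1 : ℝ)).mono_left nhdsWithin_le_nhds
    obtain ⟨ρ, ⟨h1, h2⟩, h3⟩ := (Filter.Eventually.and
      (Ioo_mem_nhdsLT (show (0 : ℝ) < 1 by norm_num) : ∀ᶠ x in _, x ∈ Set.Ioo (0 : ℝ) 1)
      (hcont.eventually_const_le (show (1 / 2 : ℝ) < 1 by norm_num))).exists
    exact ⟨ρ, h1, h2, h3⟩
  obtain ⟨δ, hδ, hgap⟩ := hf.exists_gap hsc hρ0 hρ1
  refine ⟨δ, hδ, fun α _ τ h => Set.infinite_of_forall_exists_gt fun N => ?_⟩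
  obtain ⟨M, hM⟩ := h.exists_remainderNorm_lt hf (half_pos hc)
  obtain ⟨ν, hνN, hνM, hr⟩ : ∃ ν, N < ν ∧ M ≤ ν ∧
      remainderNorm f α τ (ν + 1) ≤ ρ * remainderNorm f α τ ν := by
    by_contra! hcon
    have hpow : ∀ i : ℕ, remainderNorm f α τ (N + M + 1) * ρ ^ i ≤
        remainderNorm f α τ (N + M + 1 + i) := by
      intro i
      induction i with
      | zero => simp
      | succ i ih =>
        have h1 := hcon (N + M + 1 + i) (by omega) (by omega)
        have h2 := mul_le_mul_of_nonneg_left ih hρ0.le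
        rw [pow_succ, ← add_assoc]
        linarith
    have h1 := hpow K
    have h2 := hK α τ h (N + M + 1)
    have h3 := mul_le_mul_of_nonneg_left hρK (h.remainderNorm_pos hf (N + M + 1)).le
    linarith
  refine ⟨ν, ?_, hνN⟩
  have hunit : ∀ μ, f (Xiv f α τ μ) = 1 := fun μ => by
    have := h.remainderNorm_pos hf μ
    rw [Xiv, hf.smul _ (inv_nonneg.2 (hf.nonneg _))]
    exact inv_mul_cancel₀ this.ne'
  have hscale : ∀ μ, xiv α (τ μ).1 (τ μ).2 = remainderNorm f α τ μ • Xiv f α τ μ := fun μ =>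
    (smul_inv_smul₀ (h.remainderNorm_pos hf μ).ne' _).symm
  rw [Set.mem_ofPred_eq, hf.sub_comm]
  refine hgap _ _ (hunit ν) (hunit (ν + 1)) ?_
  have hp := h.2.1 ν
  have hp1 := (h.1 ν).1
  have hle := h.remainderNorm_le hf hcb (hM ν hνM) (q := (τ (ν + 1)).1 - (τ ν).1) (by omega)
    (by omega) ((τ (ν + 1)).2 - (τ ν).2)
  rw [← xiv_sub, hf.sub_comm, hscale, hscale] at hle
  have ha := h.remainderNorm_pos hf ν
  have hb := h.remainderNorm_pos hf (ν + 1)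
  set A := remainderNorm f α τ ν
  set B := remainderNorm f α τ (ν + 1)
  set x := Xiv f α τ ν
  set z := Xiv f α τ (ν + 1)
  have hs : 0 < B / (ρ * A) := by positivity
  have hs1 : B / (ρ * A) ≤ 1 := (div_le_one (by positivity)).2 hr
  have hcomb : A • x - B • z =
      A • ((B / (ρ * A)) • (x - ρ • z) + (1 - B / (ρ * A)) • x) := by
    match_scalars <;> field_simp
    ring
  rw [hcomb, hf.smul _ ha.le, le_mul_iff_one_le_right ha] at hle
  have := hle.trans (hf.convexComb_le hs.le hs1 _ _)
  rw [hunit ν] at this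
  nlinarith
end

section
/- (Lagarias) Let f be a norm on ℝ^n, let α ∈ ℝ^n, α ∉ ℚ^n, and set h = 2^{n+1}. Then for the f-b.s.a. sequence τ_ν = (p_ν, a_ν) to α one has p_{ν+h} ≥ 2·p_ν for every natural ν. -/
open scoped BigOperators

/-- Among `2 ^ (n + 1) + 1` integer points of `ℤ^{n+1}`, two are congruent modulo `2`. -/
lemma exists_lt_congr_two {n : ℕ} (τ : ℕ → ℤ × (Fin n → ℤ)) (ν : ℕ) :
    ∃ i j : ℕ, ν ≤ i ∧ i < j ∧ j ≤ ν + 2 ^ (n + 1) ∧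
      ∃ (q : ℤ) (b : Fin n → ℤ), (τ j).1 = (τ i).1 + 2 * q ∧
        ∀ k, (τ j).2 k = (τ i).2 k + 2 * b k := by
  let g : Fin (2 ^ (n + 1) + 1) → ZMod 2 × (Fin n → ZMod 2) := fun m =>
    (((τ (ν + m)).1 : ZMod 2), fun k => ((τ (ν + m)).2 k : ZMod 2))
  have hcard : Fintype.card (ZMod 2 × (Fin n → ZMod 2)) <
      Fintype.card (Fin (2 ^ (n + 1) + 1)) := by
    simp [ZMod.card, pow_succ, mul_comm]
  obtain ⟨x, y, hxy, hg⟩ : ∃ x y, x < y ∧ g x = g y := by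
    obtain ⟨x, y, hne, hg⟩ := Fintype.exists_ne_map_eq_of_card_lt g hcard
    rcases lt_or_gt_of_ne hne with h | h
    exacts [⟨x, y, h, hg⟩, ⟨y, x, h, hg.symm⟩]
  have hdvd : ∀ u v : ℤ, (u : ZMod 2) = v → ∃ c, v = u + 2 * c := by
    intro u v h
    obtain ⟨c, hc⟩ := (ZMod.intCast_eq_intCast_iff_dvd_sub u v 2).1 h
    exact ⟨c, by push_cast at hc; linarith⟩
  obtain ⟨q, hq⟩ := hdvd _ _ (congrArg Prod.fst hg)
  choose b hb using fun k => hdvd _ _ (congrFun (congrArg Prod.snd hg) k)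
  have := y.isLt
  exact ⟨ν + x, ν + y, by omega, by omega, by omega, q, b, hq, hb⟩

/-- **Lagarias.** With `h = 2^{n+1}` one has `p_{ν+h} ≥ 2·p_ν` for
every `ν`. -/
theorem stmt14 (n : ℕ) (f : (Fin n → ℝ) → ℝ) (hf : IsGaugeNorm f)
    (α : Fin n → ℝ) (hα : ¬ ∀ j : Fin n, ∃ q : ℚ, (q : ℝ) = α j)
    (τ : ℕ → ℤ × (Fin n → ℤ)) (hτ : IsFBSASeq f α τ) :
    ∀ ν : ℕ, 2 * (τ ν).1 ≤ (τ (ν + 2 ^ (n + 1))).1 := by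
  intro ν
  obtain ⟨hbest, hsucc, -⟩ := hτ
  have hmono : StrictMono fun m => (τ m).1 := strictMono_nat_of_lt_succ hsucc
  obtain ⟨i, j, hi, hij, hj, q, b, hq, hb⟩ := exists_lt_congr_two τ ν
  have hνi := hmono.monotone hi
  have hpij := hmono hij
  have hjν := hmono.monotone hj
  simp only at hνi hpij hjν
  by_contra! hlt
  have hlt_ji := (hbest j).2.1 (τ i).1 (τ i).2 (hbest i).1 (by omega)
  have hlt_iq := (hbest i).2.1 q b (by omega) (by omega)
  have hmid : xiv α q b = (1 / 2 : ℝ) • (xiv α (τ j).1 (τ j).2 + -xiv α (τ i).1 (τ i).2) := by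
    ext k
    simp only [xiv, Pi.smul_apply, Pi.add_apply, Pi.neg_apply, smul_eq_mul, hq, hb k]
    push_cast
    ring
  have hle := hf.add_le (xiv α (τ j).1 (τ j).2) (-xiv α (τ i).1 (τ i).2)
  rw [hf.neg] at hle
  rw [hmid, hf.smul _ (by norm_num)] at hlt_iq
  linarith
end

section
/- Let f* be the norm on ℝ² whose unit ball is {(x₁, x₂) : |x₁ + x₂| ≤ 4, |x₁ − x₂| ≤ 1}. Then there exists α = (α₁, α₂) ∈ ℝ² with 1, α₁, α₂ linearly independent over ℚ such that the f*-b.s.a. sequence to α has remainder vectors ξ_ν = p_ν α − a_ν with constant signature (+,+): both coordinates of ξ_ν are positive for every ν. -/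
open scoped BigOperators

/-- The norm `f*` on `ℝ²` with unit ball `{(x₁,x₂) : |x₁ + x₂| ≤ 4, |x₁ − x₂| ≤ 1}`. -/
noncomputable def fstar : (Fin 2 → ℝ) → ℝ :=
  fun x => max (|x 0 + x 1| / 4) |x 0 - x 1|

theorem fin_two_eq_or (i j : Fin 2) : j = i ∨ j = i + 1 := by
  revert i j; decide

theorem fin_two_add_one_add_one (i : Fin 2) : i + 1 + 1 = i := by
  revert i; decide

theorem fstar_eq (i : Fin 2) (x : Fin 2 → ℝ) :
    fstar x = max (|x i + x (i + 1)| / 4) |x i - x (i + 1)| := by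
  rcases fin_two_eq_or 0 i with rfl | rfl
  · rfl
  · change max (|x 0 + x 1| / 4) |x 0 - x 1| = max (|x 1 + x 0| / 4) |x 1 - x 0|
    rw [add_comm, abs_sub_comm]

theorem abs_sub_le_fstar (i : Fin 2) (x : Fin 2 → ℝ) : |x i - x (i + 1)| ≤ fstar x := by
  rw [fstar_eq i]; exact le_max_right _ _

theorem abs_apply_le_fstar (x : Fin 2 → ℝ) (i : Fin 2) : |x i| ≤ 5 / 2 * fstar x := by
  have h1 := abs_sub_le_fstar i x
  have h2 : |x i + x (i + 1)| / 4 ≤ fstar x := by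
    rw [fstar_eq i]; exact le_max_left _ _
  have h3 : |x i + x (i + 1)| ≤ 4 * fstar x := by linarith
  rw [abs_le] at *
  constructor <;> linarith [h1.1, h1.2, h3.1, h3.2]

/-- The open cone of positive vectors on which `fstar x = x i - x (i + 1)`. -/
def InCone (i : Fin 2) (x : Fin 2 → ℝ) : Prop :=
  0 < x (i + 1) ∧ 5 * x (i + 1) < 3 * x i

theorem InCone.pos {i : Fin 2} {x : Fin 2 → ℝ} (h : InCone i x) (j : Fin 2) : 0 < x j := by
  obtain ⟨h1, h2⟩ := h
  rcases fin_two_eq_or i j with rfl | rfl <;> linarith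

theorem InCone.fstar_eq_sub {i : Fin 2} {x : Fin 2 → ℝ} (h : InCone i x) :
    fstar x = x i - x (i + 1) := by
  obtain ⟨h1, h2⟩ := h
  rw [fstar_eq i, abs_of_pos (by linarith), abs_of_pos (by linarith)]
  exact max_eq_right (by linarith)

/-- An integer point `(p, a)`, the index `i` of the cone in which `α - a / p` is to lie, and the
radius of the box around `a / p` to which `α` is confined. -/
structure Stage where
  p : ℤ
  a : Fin 2 → ℤ
  i : Fin 2
  r : ℝ
  p_pos : 0 < p
  coprime : IsCoprime p (a (i + 1))
  r_pos : 0 < r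

/-- The box of a stage. -/
def Stage.box (s : Stage) : Set (Fin 2 → ℝ) :=
  Metric.closedBall (fun j => (s.a j : ℝ) / s.p) s.r

theorem Stage.mem_box {s : Stage} {α : Fin 2 → ℝ} :
    α ∈ s.box ↔ ∀ j, |α j - (s.a j : ℝ) / s.p| ≤ s.r := by
  simp [Stage.box, dist_pi_le_iff s.r_pos.le, Real.dist_eq]

/-- For `α` in the box of `t`, the point of `s` is a best approximation among all
denominators below that of `t`. -/
structure Stage.Refines (s t : Stage) : Prop where
  i_eq : t.i = s.i + 1
  p_lt : s.p < t.p
  det_one : s.p * t.a (s.i + 1) - t.p * s.a (s.i + 1) = 1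
  two_le_det : 2 ≤ s.p * t.a s.i - t.p * s.a s.i
  box_subset : t.box ⊆ s.box
  inCone : ∀ α ∈ t.box, InCone s.i (xiv α s.p s.a)
  abs_le : ∀ α ∈ t.box, ∀ j, |xiv α s.p s.a j| ≤ 1 / s.p
  best : ∀ α ∈ t.box, InCone t.i (xiv α t.p t.a) → ∀ (q : ℤ) (b : Fin 2 → ℤ),
    s.p ≤ q → q < t.p → fstar (xiv α s.p s.a) ≤ fstar (xiv α q b)

/-- Arbitrarily large primes `p'` occur in a point `(p', a')` whose minors with `(p, a)` are `1`
and a number `D ≥ 2` that does not depend on `p'`. -/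
theorem exists_prime_extension {p : ℤ} (hp : 0 < p) {a : Fin 2 → ℤ} {i : Fin 2}
    (h : IsCoprime p (a (i + 1))) :
    ∃ D : ℤ, 2 ≤ D ∧ ∀ M : ℤ, ∃ (p' : ℤ) (a' : Fin 2 → ℤ), M < p' ∧ Prime p' ∧
      p * a' (i + 1) - p' * a (i + 1) = 1 ∧ p * a' i - p' * a i = D := by
  obtain ⟨m, r, hmr⟩ := h
  lift p to ℕ using hp.le
  have hp0 : p ≠ 0 := by rintro rfl; simp at hp
  have : NeZero p := ⟨hp0⟩
  have hunit : IsUnit ((-r : ℤ) : ZMod p) := by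
    refine IsUnit.of_mul_eq_one ((-a (i + 1) : ℤ) : ZMod p) ?_
    have := congrArg (Int.cast : ℤ → ZMod p) hmr
    push_cast at this ⊢
    simpa using this
  let n : ℤ := |r * a i| + 2
  have hn : 2 ≤ p * n + r * a i := by
    have h1 : -|r * a i| ≤ r * a i := neg_abs_le _
    have h2 : 1 * n ≤ p * n := by
      apply mul_le_mul_of_nonneg_right (by omega)
      positivity
    simp only [n] at *
    linarith
  refine ⟨p * n + r * a i, hn, fun M => ?_⟩
  obtain ⟨P, hPM, hP, hPr⟩ := Nat.forall_exists_prime_gt_and_eq_mod hunit M.toNat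
  have hdvd : (p : ℤ) ∣ P - (-r) := by
    rw [← ZMod.intCast_zmod_eq_zero_iff_dvd, Int.cast_sub, Int.cast_natCast, hPr, sub_self]
  obtain ⟨t, ht⟩ := hdvd
  have hi : i + 1 ≠ i := by clear hmr hn n hunit; revert i; decide
  refine ⟨P, fun j => (if j = i then n else m) + t * a j, by omega,
    Nat.prime_iff_prime_int.mp hP, ?_, ?_⟩
  · simp only [hi, if_false]
    linear_combination hmr - a (i + 1) * ht
  · simp only [if_true]
    linear_combination -a i * ht

/-- An integer point off the plane of `(p, a)` and `(p', a')` has a large remainder with respect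
to `a' / p'`. -/
theorem le_of_offplane {p p' q D a₁ a₂ a₁' a₂' b₁ b₂ : ℤ} (hD : 2 ≤ D)
    (h₂ : p * a₂' - p' * a₂ = 1) (h₁ : p * a₁' - p' * a₁ = D)
    (hne : D * (q * a₂' - p' * b₂) ≠ q * a₁' - p' * b₁) :
    p' ≤ (D + 1) * max |q * a₁' - p' * b₁| |q * a₂' - p' * b₂| := by
  set X := q * a₁' - p' * b₁ with hX
  set Y := q * a₂' - p' * b₂ with hY
  have hdvd : p' ∣ D * Y - X :=
    ⟨q * (a₁' * a₂ - a₁ * a₂') - D * b₂ + b₁, by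
      rw [hX, hY]; linear_combination q * a₁' * h₂ - q * a₂' * h₁⟩
  have h1 : p' ≤ |D * Y - X| :=
    Int.le_of_dvd (abs_pos.mpr (sub_ne_zero.mpr hne)) ((dvd_abs _ _).mpr hdvd)
  have h2 : |D * Y - X| ≤ |D * Y| + |X| := abs_sub _ _
  rw [abs_mul, abs_of_pos (by omega : 0 < D)] at h2
  have h3 : D * |Y| ≤ D * max |X| |Y| := by gcongr; exact le_max_right _ _
  have h4 : |X| ≤ max |X| |Y| := le_max_left _ _
  linarith

/-- An integer point in the plane of `(p, a)` and `(p', a')` is an integral combination of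
them. -/
theorem exists_combination {p p' q D : ℤ} {a a' b : Fin 2 → ℤ} {i : Fin 2} (hp' : 0 < p')
    (h₂ : p * a' (i + 1) - p' * a (i + 1) = 1) (h₁ : p * a' i - p' * a i = D)
    (h : D * (q * a' (i + 1) - p' * b (i + 1)) = q * a' i - p' * b i) :
    ∃ x y : ℤ, q = x * p + y * p' ∧ ∀ j, b j = x * a j + y * a' j := by
  have hq : q = (q * a' (i + 1) - p' * b (i + 1)) * p + (p * b (i + 1) - q * a (i + 1)) * p' := by
    linear_combination -q * h₂
  refine ⟨_, _, hq, fun j => ?_⟩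
  rcases fin_two_eq_or i j with rfl | rfl
  · apply mul_left_cancel₀ hp'.ne'
    linear_combination h + a' j * hq + (q * a' (j + 1) - p' * b (j + 1)) * h₁
  · linear_combination -b (i + 1) * h₂

theorem fstar_le_of_combination {α : Fin 2 → ℝ} {p p' q x y : ℤ} {a a' b : Fin 2 → ℤ}
    {i : Fin 2} (hp : 0 < p) (hp' : 0 < p') (h : InCone i (xiv α p a))
    (h' : InCone (i + 1) (xiv α p' a')) (hpq : p ≤ q) (hqp : q < p')
    (hq : q = x * p + y * p') (hb : ∀ j, b j = x * a j + y * a' j) :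
    fstar (xiv α p a) ≤ fstar (xiv α q b) := by
  rw [h.fstar_eq_sub]
  refine le_trans ?_ (abs_sub_le_fstar i _)
  have hξ : xiv α q b i - xiv α q b (i + 1) =
      x * (xiv α p a i - xiv α p a (i + 1)) -
        y * (xiv α p' a' (i + 1) - xiv α p' a' i) := by
    simp only [xiv, hb, hq]
    push_cast
    ring
  have hV : 0 < xiv α p a i - xiv α p a (i + 1) := by linarith [h.1, h.2]
  have hV' : 0 < xiv α p' a' (i + 1) - xiv α p' a' i := by
    obtain ⟨c1, c2⟩ := h'
    rw [fin_two_add_one_add_one] at c1 c2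
    linarith
  rw [hξ, le_abs]
  rcases lt_trichotomy x 0 with hx0 | rfl | hx0
  · have hy0 : 0 ≤ y := by
      by_contra! hcon
      nlinarith
    right
    have : (x : ℝ) ≤ -1 := by exact_mod_cast (by omega : x ≤ -1)
    have : (0 : ℝ) ≤ y := by exact_mod_cast hy0
    nlinarith
  · exfalso
    rcases le_or_gt y 0 with hy0 | hy0 <;> nlinarith
  · have hy0 : y ≤ 0 := by
      by_contra! hcon
      nlinarith
    left
    have : (1 : ℝ) ≤ x := by exact_mod_cast hx0
    have : (y : ℝ) ≤ 0 := by exact_mod_cast hy0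
    nlinarith

theorem fstar_ge_of_le {α : Fin 2 → ℝ} {p' q D : ℤ} {a' b : Fin 2 → ℤ} {j : Fin 2} {r' : ℝ}
    (hp' : 0 < p') (hq : 0 ≤ q) (hqp : q ≤ p') (hD : 0 ≤ D)
    (hα : |α j - (a' j : ℝ) / p'| ≤ r') (hr' : ((D : ℝ) + 1) * (p' * r') ≤ 1 / 8)
    (h : p' ≤ (D + 1) * |q * a' j - p' * b j|) :
    7 / 20 ≤ (D + 1) * fstar (xiv α q b) := by
  have hR : (p' : ℝ) ≤ (D + 1) * |(q : ℝ) * a' j - p' * b j| := by exact_mod_cast h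
  have hpR : (0 : ℝ) < p' := by exact_mod_cast hp'
  have hqR : (q : ℝ) ≤ p' := by exact_mod_cast hqp
  have hq0 : (0 : ℝ) ≤ q := by exact_mod_cast hq
  have hD0 : (0 : ℝ) ≤ D := by exact_mod_cast hD
  have e : (q : ℝ) * a' j - p' * b j = p' * (xiv α q b j - q * (α j - (a' j : ℝ) / p')) := by
    rw [xiv]; field_simp; ring
  have h1 : |xiv α q b j - q * (α j - (a' j : ℝ) / p')| ≤
      |xiv α q b j| + q * |α j - (a' j : ℝ) / p'| := by
    refine (abs_sub _ _).trans ?_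
    rw [abs_mul, abs_of_nonneg hq0]
  have h2 : q * |α j - (a' j : ℝ) / p'| ≤ p' * r' := by gcongr
  rw [e, abs_mul, abs_of_pos hpR] at hR
  have h3 : 1 ≤ ((D : ℝ) + 1) * |xiv α q b j - q * (α j - (a' j : ℝ) / p')| := by
    refine le_of_mul_le_mul_left (a := (p' : ℝ)) ?_ hpR
    linarith
  have h4 : 1 ≤ ((D : ℝ) + 1) * (5 / 2 * fstar (xiv α q b) + p' * r') := by
    refine h3.trans ?_
    gcongr
    linarith [abs_apply_le_fstar (xiv α q b) j]
  linarith

theorem Stage.exists_refines (s : Stage) : ∃ t, s.Refines t := by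
  obtain ⟨p, a, i, r, hp, hcop, hr⟩ := s
  obtain ⟨D, hD, hext⟩ := exists_prime_extension hp hcop
  obtain ⟨M, hM⟩ := exists_int_gt (((D : ℝ) + 1) / r)
  obtain ⟨p', a', hlt, hprime, h₂, h₁⟩ :=
    hext (max M (max (p * (D + 1)) (3 * (D + 1) ^ 2)))
  simp only [max_lt_iff] at hlt
  obtain ⟨hMp, hpp, hDp⟩ := hlt
  have hDle : D + 1 ≤ 3 * (D + 1) ^ 2 := by nlinarith
  have hp' : 0 < p' := by linarith
  have hcop' : IsCoprime p' (a' i) := by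
    refine (hprime.coprime_iff_not_dvd).mpr fun hdvd => ?_
    have : p' ∣ D := by
      rw [← h₁]; exact dvd_sub (hdvd.mul_left _) (dvd_mul_right _ _)
    have := Int.le_of_dvd (by omega) this
    linarith
  have hpR : (1 : ℝ) ≤ p := by exact_mod_cast hp
  have hpR' : (0 : ℝ) < p' := by exact_mod_cast hp'
  have hDR : (2 : ℝ) ≤ D := by exact_mod_cast hD
  have h₂R : (p : ℝ) * a' (i + 1) - p' * a (i + 1) = 1 := by exact_mod_cast h₂
  have h₁R : (p : ℝ) * a' i - p' * a i = D := by exact_mod_cast h₁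
  have hppR : (p : ℝ) * (D + 1) < p' := by exact_mod_cast hpp
  have hDpR : 3 * ((D : ℝ) + 1) ^ 2 < p' := by exact_mod_cast hDp
  have hMR : ((D : ℝ) + 1) / r < p' := hM.trans (by exact_mod_cast hMp)
  set r' : ℝ := 1 / (8 * p * p' * (D + 1)) with hr'
  have hr'pos : 0 < r' := by positivity
  have hr'mul : r' * p' * p * (D + 1) = 1 / 8 := by rw [hr']; field_simp
  -- the remainder of `(p, a)` is close to `(D, 1) / p'`
  have key : ∀ α : Fin 2 → ℝ, (∀ j, |α j - (a' j : ℝ) / p'| ≤ r') →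
      (|p' * xiv α p a i - D| ≤ 1 / 24 ∧ |p' * xiv α p a (i + 1) - 1| ≤ 1 / 24) := by
    intro α hα
    have hgen : ∀ (j : Fin 2) (d : ℝ), (p : ℝ) * a' j - p' * a j = d →
        |p' * xiv α p a j - d| ≤ 1 / 24 := by
      intro j d hd
      have e : p' * xiv α p a j - d = p' * p * (α j - (a' j : ℝ) / p') := by
        rw [← hd, xiv]; field_simp; ring
      rw [e, abs_mul, abs_of_pos (by positivity)]
      have h1 : p' * p * |α j - (a' j : ℝ) / p'| ≤ p' * p * r' := by gcongr; exact hα j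
      have h2 : (p' * p * r') * 3 ≤ (p' * p * r') * (D + 1) := by gcongr; linarith
      nlinarith
    exact ⟨hgen i _ h₁R, hgen (i + 1) _ h₂R⟩
  have hcone : ∀ α : Fin 2 → ℝ, (∀ j, |α j - (a' j : ℝ) / p'| ≤ r') →
      InCone i (xiv α p a) := by
    intro α hα
    obtain ⟨k1, k2⟩ := key α hα
    rw [abs_le] at k1 k2
    constructor
    · refine pos_of_mul_pos_right (a := (p' : ℝ)) (by linarith) hpR'.le
    · refine lt_of_mul_lt_mul_left (a := (p' : ℝ)) (by linarith) hpR'.le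
  have hsmall : ∀ α : Fin 2 → ℝ, (∀ j, |α j - (a' j : ℝ) / p'| ≤ r') →
      ∀ j, |xiv α p a j| ≤ (D + 1) / p' := by
    intro α hα j
    obtain ⟨k1, k2⟩ := key α hα
    rw [abs_le] at k1 k2
    rw [abs_of_pos ((hcone α hα).pos j), le_div_iff₀ hpR']
    rcases fin_two_eq_or i j with rfl | rfl <;> linarith
  refine ⟨⟨p', a', i + 1, r', hp', by rwa [fin_two_add_one_add_one], hr'pos⟩, rfl, ?_, h₂,
    by simpa [h₁] using hD, fun α hα => ?_, fun α hα => ?_, fun α hα j => ?_,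
    fun α hα hc q b hpq hqp => ?_⟩
  · change p < p'
    nlinarith
  · rw [Stage.mem_box] at hα ⊢
    intro j
    have h := hsmall α hα j
    have e : α j - (a j : ℝ) / p = xiv α p a j / p := by rw [xiv]; field_simp
    change |α j - (a j : ℝ) / p| ≤ r
    rw [e, abs_div, abs_of_pos (by linarith : (0 : ℝ) < p)]
    rw [div_lt_iff₀ hr] at hMR
    calc |xiv α p a j| / p ≤ |xiv α p a j| := div_le_self (abs_nonneg _) hpR
      _ ≤ _ := h
      _ ≤ r := by rw [div_le_iff₀ hpR']; linarith
  · exact hcone α (Stage.mem_box.mp hα)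
  · refine (hsmall α (Stage.mem_box.mp hα) j).trans ?_
    change _ ≤ 1 / (p : ℝ)
    rw [div_le_div_iff₀ hpR' (by linarith)]
    linarith
  · replace hα : ∀ j, |α j - (a' j : ℝ) / p'| ≤ r' := Stage.mem_box.mp hα
    change InCone (i + 1) (xiv α p' a') at hc
    change p ≤ q at hpq
    change q < p' at hqp
    change fstar (xiv α p a) ≤ _
    have hcτ := hcone α hα
    by_cases hplane : D * (q * a' (i + 1) - p' * b (i + 1)) = q * a' i - p' * b i
    · obtain ⟨x, y, hq, hb⟩ := exists_combination hp' h₂ h₁ hplane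
      exact fstar_le_of_combination hp hp' hcτ hc hpq hqp hq hb
    · have hfar : 7 / 20 ≤ (D + 1) * fstar (xiv α q b) := by
        have hle := le_of_offplane hD h₂ h₁ hplane
        have hclose : ((D : ℝ) + 1) * (p' * r') ≤ 1 / 8 := by
          rw [← hr'mul]
          have : 0 ≤ ((D : ℝ) + 1) * (p' * r') := by positivity
          nlinarith
        rcases max_choice |q * a' i - p' * b i| |q * a' (i + 1) - p' * b (i + 1)| with hm | hm <;>
        rw [hm] at hle <;>
        exact fstar_ge_of_le hp' (by omega) (by omega) (by omega) (hα _) hclose hle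
      have hnear : xiv α p a i - xiv α p a (i + 1) ≤ (D + 1) / p' := by
        linarith [hsmall α hα i, le_abs_self (xiv α p a i), hcτ.1]
      rw [hcτ.fstar_eq_sub]
      refine hnear.trans ?_
      rw [div_le_iff₀ hpR']
      refine le_of_mul_le_mul_left (a := (D + 1 : ℝ)) ?_ (by linarith)
      nlinarith

theorem exists_seq_refines : ∃ S : ℕ → Stage, (S 0).p = 1 ∧ ∀ k, (S k).Refines (S (k + 1)) := by
  choose next hnext using Stage.exists_refines
  let s₀ : Stage := ⟨1, 0, 0, 1, one_pos, isCoprime_one_left, one_pos⟩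
  exact ⟨fun k => Nat.rec s₀ (fun _ => next) k, rfl, fun k => hnext _⟩

theorem exists_mem_boxes {S : ℕ → Stage} (hS : ∀ k, (S k).Refines (S (k + 1))) :
    ∃ α, ∀ k, α ∈ (S k).box := by
  obtain ⟨α, hα⟩ := IsCompact.nonempty_iInter_of_sequence_nonempty_isCompact_isClosed
    (fun k => (S k).box) (fun k => (hS k).box_subset)
    (fun k => ⟨_, Metric.mem_closedBall_self (S k).r_pos.le⟩)
    (isCompact_closedBall _ _) (fun k => Metric.isClosed_closedBall)
  exact ⟨α, Set.mem_iInter.mp hα⟩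

theorem lt_p_of_refines {S : ℕ → Stage} (hS : ∀ k, (S k).Refines (S (k + 1))) (k : ℕ) :
    (k : ℤ) < (S k).p := by
  induction k with
  | zero => exact (S 0).p_pos
  | succ k ih => have := (hS k).p_lt; push_cast; omega

theorem linearIndependent_of_mem_boxes {S : ℕ → Stage}
    (hS : ∀ k, (S k).Refines (S (k + 1))) {α : Fin 2 → ℝ} (hα : ∀ k, α ∈ (S k).box)
    (c : Fin 3 → ℤ) (hc : (c 0 : ℝ) + ∑ j : Fin 2, (c j.succ : ℝ) * α j = 0) : c = 0 := by
  have hsum : ∀ (i : Fin 2) (g : Fin 2 → ℤ), ∑ j, g j = g i + g (i + 1) := by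
    intro i g
    rcases fin_two_eq_or 0 i with rfl | rfl
    · exact Fin.sum_univ_two g
    · rw [Fin.sum_univ_two, add_comm]; rfl
  have hvanish : ∀ k : ℕ, |c 1| + |c 2| ≤ k →
      c 0 * (S k).p + ∑ j : Fin 2, c j.succ * (S k).a j = 0 := by
    intro k hk
    have hlt := lt_p_of_refines hS k
    have hpR : (0 : ℝ) < (S k).p := by exact_mod_cast (S k).p_pos
    have hb := (hS k).abs_le α (hα (k + 1))
    rw [Fin.sum_univ_two] at hc
    have e : ((c 0 * (S k).p + ∑ j : Fin 2, c j.succ * (S k).a j : ℤ) : ℝ) =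
        -(c 1 * xiv α (S k).p (S k).a 0 + c 2 * xiv α (S k).p (S k).a 1) := by
      rw [Fin.sum_univ_two]
      simp only [xiv]
      push_cast
      simp only [Fin.succ_zero_eq_one, Fin.succ_one_eq_two] at hc ⊢
      linear_combination (S k).p * hc
    have hbound : |((c 0 * (S k).p + ∑ j : Fin 2, c j.succ * (S k).a j : ℤ) : ℝ)| < 1 := by
      rw [e, abs_neg]
      have hlt' : (|(c 1 : ℝ)| + |(c 2 : ℝ)|) < (S k).p := by exact_mod_cast hk.trans_lt hlt
      calc _ ≤ |(c 1 : ℝ)| * |xiv α (S k).p (S k).a 0| +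
            |(c 2 : ℝ)| * |xiv α (S k).p (S k).a 1| := by
            rw [← abs_mul, ← abs_mul]; exact abs_add_le _ _
        _ ≤ |(c 1 : ℝ)| * (1 / (S k).p) + |(c 2 : ℝ)| * (1 / (S k).p) := by
            gcongr <;> exact hb _
        _ = (|(c 1 : ℝ)| + |(c 2 : ℝ)|) / (S k).p := by ring
        _ < 1 := by rwa [div_lt_one hpR]
    exact Int.abs_lt_one_iff.mp (by exact_mod_cast hbound)
  have hrel : ∀ k : ℕ, |c 1| + |c 2| ≤ k → ∃ D : ℤ, 2 ≤ D ∧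
      c (S k).i.succ * D + c ((S k).i + 1).succ = 0 := by
    intro k hk
    have h1 := hvanish k hk
    have h2 := hvanish (k + 1) (by push_cast; omega)
    rw [hsum (S k).i] at h1 h2
    refine ⟨_, (hS k).two_le_det, ?_⟩
    linear_combination (S k).p * h2 - (S (k + 1)).p * h1 -
      c ((S k).i + 1).succ * (hS k).det_one
  obtain ⟨k, hk⟩ : ∃ k : ℕ, |c 1| + |c 2| ≤ k := ⟨_, Int.self_le_toNat _⟩
  obtain ⟨D, hD, hD0⟩ := hrel k hk
  obtain ⟨D', hD', hD0'⟩ := hrel (k + 1) (by push_cast; omega)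
  rw [(hS k).i_eq, fin_two_add_one_add_one] at hD0'
  have hi : c (S k).i.succ = 0 := by
    have : c (S k).i.succ * (1 - D * D') = 0 := by linear_combination hD0' - D' * hD0
    rcases mul_eq_zero.mp this with h | h
    · exact h
    · nlinarith
  have hi' : c ((S k).i + 1).succ = 0 := by simpa [hi] using hD0
  have hsucc : ∀ j : Fin 2, c j.succ = 0 := by
    intro j
    rcases fin_two_eq_or (S k).i j with h | h <;> rw [h] <;> assumption
  have h0 : c 0 = 0 := by
    have := hvanish k hk
    simpa [hsucc, (S k).p_pos.ne'] using this
  funext j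
  exact Fin.cases h0 hsucc j

theorem pos_of_isFBSA {S : ℕ → Stage} (h0 : (S 0).p = 1)
    (hS : ∀ k, (S k).Refines (S (k + 1))) {α : Fin 2 → ℝ} (hα : ∀ k, α ∈ (S k).box)
    {q : ℤ} {b : Fin 2 → ℤ} (h : IsFBSA fstar α q b) (j : Fin 2) : 0 < xiv α q b j := by
  obtain ⟨hq, hlt, hne⟩ := h
  obtain ⟨k, hk, hk'⟩ : ∃ k, (S k).p ≤ q ∧ q < (S (k + 1)).p := by
    have hex : ∃ k, q < (S k).p :=
      ⟨q.toNat, (Int.self_le_toNat q).trans_lt (lt_p_of_refines hS _)⟩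
    classical
    obtain ⟨m, hm⟩ : ∃ m, Nat.find hex = m + 1 := by
      refine Nat.exists_eq_succ_of_ne_zero fun hz => ?_
      have := Nat.find_spec hex
      rw [hz, h0] at this
      omega
    refine ⟨m, not_lt.mp (Nat.find_min hex (by omega)), ?_⟩
    rw [← hm]
    exact Nat.find_spec hex
  have hbest := (hS k).best α (hα _) ((hS (k + 1)).inCone α (hα _)) q b hk hk'
  rcases hk.eq_or_lt with heq | hklt
  · by_cases hb : b = (S k).a
    · rw [hb, ← heq]
      exact ((hS k).inCone α (hα _)).pos j
    · have := hne (S k).a (Ne.symm hb)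
      rw [← heq] at this hbest
      exact absurd hbest this.not_ge
  · exact absurd hbest (hlt (S k).p (S k).a (S k).p_pos (by omega)).not_ge

/-- For the norm `f*` there is `α = (α₁, α₂)` with `1, α₁, α₂` linearly
independent over `ℚ` whose `f*`-b.s.a. remainder vectors all have signature `(+,+)`. -/
theorem stmt17 :
    ∃ α : Fin 2 → ℝ,
      (∀ c : Fin 3 → ℤ,
        ((c 0 : ℝ) + ∑ j : Fin 2, (c j.succ : ℝ) * α j = 0) → c = 0) ∧
      ∀ τ : ℕ → ℤ × (Fin 2 → ℤ), IsFBSASeq fstar α τ →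
        ∀ ν : ℕ, ∀ j : Fin 2, 0 < xiv α (τ ν).1 (τ ν).2 j := by
  obtain ⟨S, h0, hS⟩ := exists_seq_refines
  obtain ⟨α, hα⟩ := exists_mem_boxes hS
  exact ⟨α, linearIndependent_of_mem_boxes hS hα,
    fun τ hτ ν j => pos_of_isFBSA h0 hS hα (hτ.1 ν) j⟩
end
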